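/- [Running forward–backward splitting, tracking convergence] Let M > 0 and λ ∈ (0, 2/M). For k = 1, 2, … let f_k : E → ℝ be differentiable, strongly convex with constant m_k > 0, with gradient ∇f_k Lipschitz with constant M_k, where m_k ≤ M_k ≤ M; let g_k : E → ℝ be convex and K_k ⊆ E nonempty closed convex. Suppose x*_k ∈ K_k is the minimizer over K_k of y ↦ g_k(y) + (1/(2λ))‖y − (x*_k − λ·∇f_k(x*_k))‖² and ‖x*_{k+1} − x*_k‖ ≤ δ. Set L_k = max{|1 − λm_k|, |1 − λM_k|} and suppose L̄ ∈ (0,1) satisfies L_k ≤ L̄ for all k. Then the running forward–backward iteration, where x_{k+1} is the minimizer over K_k of y ↦ g_k(y) + (1/(2λ))‖y − (x_k − λ·∇f_k(x_k))‖², satisfies for every k ≥ 1: ‖x_k − x*_k‖ ≤ (L₁⋯L_{k−1})·‖x₁ − x*₁‖ + δ·(1 − L̄^{k−1})/(1 − L̄). -/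

import Mathlib

lemma fb_line_deriv {E : Type*} [NormedAddCommGroup E] [InnerProductSpace ℝ E] [CompleteSpace E]
    (f : E → ℝ) (f' : E → E) (hgrad : ∀ x, HasGradientAt f (f' x) x) (x d : E) (t : ℝ) :
    HasDerivAt (fun s : ℝ => f (x + s • d)) (inner ℝ (f' (x + t • d)) d) t := by
  have h1 : HasDerivAt (fun s : ℝ => x + s • d) d t := by
    simpa using ((hasDerivAt_id t).smul_const d).const_add x
  have h2 := (hgrad (x + t • d)).hasFDerivAt
  have h3 := h2.comp_hasDerivAt t h1
  simpa [Function.comp_def] using h3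

lemma fb_descent {E : Type*} [NormedAddCommGroup E] [InnerProductSpace ℝ E] [CompleteSpace E]
    (f : E → ℝ) (f' : E → E) (M : ℝ) (hgrad : ∀ x, HasGradientAt f (f' x) x)
    (hlip : ∀ x y, ‖f' x - f' y‖ ≤ M * ‖x - y‖) (x d : E) :
    f (x + d) ≤ f x + inner ℝ (f' x) d + M / 2 * ‖d‖ ^ 2 := by
  have hd : ∀ t : ℝ, HasDerivAt
      (fun s : ℝ => f (x + s • d) - s * inner ℝ (f' x) d - M / 2 * ‖d‖ ^ 2 * s ^ 2)
      (inner ℝ (f' (x + t • d)) d - inner ℝ (f' x) d - M * ‖d‖ ^ 2 * t) t := by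
    intro t
    have h := ((fb_line_deriv f f' hgrad x d t).sub
      ((hasDerivAt_id t).mul_const (inner ℝ (f' x) d))).sub
      ((hasDerivAt_pow 2 t).const_mul (M / 2 * ‖d‖ ^ 2))
    refine h.congr_deriv ?_
    simp
    ring
  have hanti : AntitoneOn
      (fun s : ℝ => f (x + s • d) - s * inner ℝ (f' x) d - M / 2 * ‖d‖ ^ 2 * s ^ 2)
      (Set.Ici 0) := by
    apply antitoneOn_of_deriv_nonpos (convex_Ici 0)
    · exact fun t _ => (hd t).continuousAt.continuousWithinAt
    · exact fun t _ => (hd t).differentiableAt.differentiableWithinAt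
    · intro t ht
      rw [interior_Ici] at ht
      have ht : 0 < t := ht
      rw [(hd t).deriv, ← inner_sub_left]
      have h1 := real_inner_le_norm (f' (x + t • d) - f' x) d
      have h2 := hlip (x + t • d) x
      rw [add_sub_cancel_left, norm_smul, Real.norm_of_nonneg ht.le] at h2
      nlinarith [mul_le_mul_of_nonneg_right h2 (norm_nonneg d)]
  have := hanti (a := 0) (b := 1) (by simp) (by simp) (by norm_num)
  simp at this
  linarith

lemma fb_convex_grad {E : Type*} [NormedAddCommGroup E] [InnerProductSpace ℝ E] [CompleteSpace E]
    (f : E → ℝ) (f' : E → E) (m : ℝ) (hgrad : ∀ x, HasGradientAt f (f' x) x)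
    (hsc : ConvexOn ℝ Set.univ (fun x => f x - m / 2 * ‖x‖ ^ 2)) (x d : E) :
    f x + inner ℝ (f' x) d + m / 2 * ‖d‖ ^ 2 ≤ f (x + d) := by
  have hc : ConvexOn ℝ Set.univ (fun s : ℝ => f (x + s • d) - m / 2 * ‖x + s • d‖ ^ 2) := by
    have := hsc.comp_affineMap (AffineMap.lineMap x (x + d))
    rw [Set.preimage_univ] at this
    refine this.congr ?_
    intro s _
    simp [AffineMap.lineMap_apply, add_comm]
  have hn : ∀ s : ℝ, ‖x + s • d‖ ^ 2 = ‖x‖ ^ 2 + 2 * inner ℝ x d * s + ‖d‖ ^ 2 * s ^ 2 := by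
    intro s
    rw [norm_add_sq_real, inner_smul_right, norm_smul, mul_pow, Real.norm_eq_abs, sq_abs]; ring
  simp only [hn] at hc
  have hd : HasDerivAt (fun s : ℝ => f (x + s • d)
      - m / 2 * (‖x‖ ^ 2 + 2 * inner ℝ x d * s + ‖d‖ ^ 2 * s ^ 2))
      (inner ℝ (f' x) d - m * inner ℝ x d) 0 := by
    have h := (fb_line_deriv f f' hgrad x d 0).sub
      ((((((hasDerivAt_id (0:ℝ)).const_mul (2 * inner ℝ x d)).const_add (‖x‖ ^ 2))).add
      ((hasDerivAt_pow 2 (0:ℝ)).const_mul (‖d‖ ^ 2))).const_mul (m / 2))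
    refine h.congr_deriv ?_
    simp
    ring
  have := hc.le_slope_of_hasDerivAt (x := 0) (y := 1) (Set.mem_univ _) (Set.mem_univ _)
    (by norm_num) hd
  simp [slope_def_field] at this
  linarith

lemma fb_cocoercive {E : Type*} [NormedAddCommGroup E] [InnerProductSpace ℝ E] [CompleteSpace E]
    (f : E → ℝ) (f' : E → E) (m M : ℝ) (hmM : m ≤ M) (hgrad : ∀ x, HasGradientAt f (f' x) x)
    (hsc : ConvexOn ℝ Set.univ (fun x => f x - m / 2 * ‖x‖ ^ 2))
    (hlip : ∀ x y, ‖f' x - f' y‖ ≤ M * ‖x - y‖) (x y H : E)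
    (hH : H = (f' x - f' y) - m • (x - y)) :
    ‖H‖ ^ 2 ≤ (M - m) * inner ℝ H (x - y) := by
  have key : ∀ (x y H : E), H = (f' x - f' y) - m • (x - y) → ∀ t : ℝ,
      f x + inner ℝ (f' x) (y - x) + m / 2 * ‖y - x‖ ^ 2
        + t * ‖H‖ ^ 2 - (M - m) / 2 * t ^ 2 * ‖H‖ ^ 2 ≤ f y := by
    intro x y H hH t
    have h1 := fb_descent f f' M hgrad hlip y (t • H)
    have h2 := fb_convex_grad f f' m hgrad hsc x ((y - x) + t • H)
    rw [show x + (y - x + t • H) = y + t • H by abel] at h2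
    rw [norm_add_sq_real, inner_add_right] at h2
    simp only [inner_smul_right, norm_smul, mul_pow, Real.norm_eq_abs, sq_abs] at h1 h2
    have h3 : ‖H‖ ^ 2 = inner ℝ (f' x) H - inner ℝ (f' y) H + m * inner ℝ (y - x) H := by
      rw [← real_inner_self_eq_norm_sq]
      nth_rw 1 [hH]
      simp only [inner_sub_left, inner_smul_left]
      simp
      ring
    nlinarith [congrArg (fun z => t * z) h3]
  have hs : ∀ t : ℝ, 2 * t * ‖H‖ ^ 2 - (M - m) * t ^ 2 * ‖H‖ ^ 2 ≤ inner ℝ H (x - y) := by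
    intro t
    have h1 := key x y H hH t
    have h2 := key y x (-H) (by rw [hH, ← neg_sub x y, smul_neg]; abel) t
    rw [norm_neg] at h2
    have h3 : inner ℝ H (x - y) = inner ℝ (f' x) (x - y) - inner ℝ (f' y) (x - y)
        - m * ‖x - y‖ ^ 2 := by
      rw [hH, ← real_inner_self_eq_norm_sq, inner_sub_left, inner_sub_left, inner_smul_left]
      simp
    rw [← neg_sub x y, norm_neg, inner_neg_right] at h1
    linarith
  have h0 := hs 0
  simp at h0
  rcases hmM.eq_or_lt with h | h
  · subst h
    simp at hs ⊢
    by_contra hne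
    have hp : 0 < ‖H‖ ^ 2 := by positivity
    have := hs ((inner ℝ H (x - y) + 1) / ‖H‖ ^ 2)
    rw [mul_assoc, div_mul_cancel₀ _ hp.ne'] at this
    linarith
  · have hl : 0 < M - m := sub_pos.2 h
    have := hs (1 / (M - m))
    have e : 2 * (1 / (M - m)) * ‖H‖ ^ 2 - (M - m) * (1 / (M - m)) ^ 2 * ‖H‖ ^ 2
      = ‖H‖ ^ 2 / (M - m) := by field_simp; ring
    rw [e, div_le_iff₀ hl] at this
    linarith

lemma fb_forward {E : Type*} [NormedAddCommGroup E] [InnerProductSpace ℝ E] [CompleteSpace E]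
    (f : E → ℝ) (f' : E → E) (m M lam : ℝ) (hlam : 0 < lam)
    (hmM : m ≤ M) (hgrad : ∀ x, HasGradientAt f (f' x) x)
    (hsc : ConvexOn ℝ Set.univ (fun x => f x - m / 2 * ‖x‖ ^ 2))
    (hlip : ∀ x y, ‖f' x - f' y‖ ≤ M * ‖x - y‖) (x y : E) :
    ‖(x - lam • f' x) - (y - lam • f' y)‖
      ≤ max |1 - lam * m| |1 - lam * M| * ‖x - y‖ := by
  obtain ⟨H, hH⟩ : ∃ H, H = (f' x - f' y) - m • (x - y) := ⟨_, rfl⟩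
  have hco := fb_cocoercive f f' m M hmM hgrad hsc hlip x y H hH
  have hup : inner ℝ H (x - y) ≤ (M - m) * ‖x - y‖ ^ 2 := by
    have h1 := real_inner_le_norm (f' x - f' y) (x - y)
    have h2 := mul_le_mul_of_nonneg_right (hlip x y) (norm_nonneg (x - y))
    rw [hH, inner_sub_left, inner_smul_left, real_inner_self_eq_norm_sq]
    simp only [conj_trivial]
    nlinarith
  have hlo : 0 ≤ inner ℝ H (x - y) := by
    have h1 := fb_convex_grad f f' m hgrad hsc x (y - x)
    have h2 := fb_convex_grad f f' m hgrad hsc y (x - y)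
    rw [← neg_sub x y, norm_neg, inner_neg_right, neg_sub, add_sub_cancel] at h1
    rw [add_sub_cancel] at h2
    rw [hH, inner_sub_left, inner_sub_left, inner_smul_left, real_inner_self_eq_norm_sq]
    simp only [conj_trivial]
    linarith
  have e : (x - lam • f' x) - (y - lam • f' y) = (1 - lam * m) • (x - y) - lam • H := by
    rw [hH]; module
  have hmax : 0 ≤ max |1 - lam * m| |1 - lam * M| := le_max_of_le_left (abs_nonneg _)
  apply le_of_sq_le_sq _ (by positivity)
  rw [e, norm_sub_sq_real, mul_pow, norm_smul, norm_smul, mul_pow, mul_pow, inner_smul_left,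
    inner_smul_right, real_inner_comm, Real.norm_eq_abs, Real.norm_eq_abs, sq_abs, sq_abs]
  simp only [conj_trivial]
  have hA : (1 - lam * m) ^ 2 ≤ (max |1 - lam * m| |1 - lam * M|) ^ 2 := by
    rw [← sq_abs]; gcongr; exact le_max_left _ _
  have hB : (1 - lam * M) ^ 2 ≤ (max |1 - lam * m| |1 - lam * M|) ^ 2 := by
    rw [← sq_abs]; gcongr; exact le_max_right _ _
  have hA' := mul_le_mul_of_nonneg_right hA (sq_nonneg ‖x - y‖)
  have hB' := mul_le_mul_of_nonneg_right hB (sq_nonneg ‖x - y‖)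
  have hco' := mul_le_mul_of_nonneg_left hco (sq_nonneg lam)
  generalize (inner ℝ H (x - y) : ℝ) = p at *
  rcases le_total 0 ((1 - lam * m) + (1 - lam * M)) with h | h
  · have := mul_nonneg (mul_nonneg hlam.le hlo) h
    linarith
  · have := mul_nonneg (mul_nonneg hlam.le (sub_nonneg.2 hup)) (neg_nonneg.2 h)
    linarith

lemma fb_prox {E : Type*} [NormedAddCommGroup E] [InnerProductSpace ℝ E]
    (g : E → ℝ) (hg : ConvexOn ℝ Set.univ g) (K : Set E) (hK : Convex ℝ K) (c : ℝ) (hc : 0 < c)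
    (p q u v : E) (hp : p ∈ K) (hq : q ∈ K)
    (hpm : ∀ y ∈ K, g p + c * ‖p - u‖ ^ 2 ≤ g y + c * ‖y - u‖ ^ 2)
    (hqm : ∀ y ∈ K, g q + c * ‖q - v‖ ^ 2 ≤ g y + c * ‖y - v‖ ^ 2) :
    ‖p - q‖ ≤ ‖u - v‖ := by
  have key : ∀ (p q u : E), p ∈ K → q ∈ K →
      (∀ y ∈ K, g p + c * ‖p - u‖ ^ 2 ≤ g y + c * ‖y - u‖ ^ 2) →
      ∀ t : ℝ, 0 < t → t ≤ 1 →
      0 ≤ (g q - g p) + c * (2 * inner ℝ (p - u) (q - p) + t * ‖q - p‖ ^ 2) := by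
    intro p q u hp hq hm t ht ht1
    have h1 := hm _ (hK hp hq (sub_nonneg.2 ht1) ht.le (by ring))
    have h2 := hg.2 (Set.mem_univ p) (Set.mem_univ q) (sub_nonneg.2 ht1) ht.le (by ring)
    rw [show (1 - t) • p + t • q - u = (p - u) + t • (q - p) by module, norm_add_sq_real,
      inner_smul_right, norm_smul, mul_pow, Real.norm_eq_abs, sq_abs] at h1
    simp only [smul_eq_mul] at h2
    refine nonneg_of_mul_nonneg_right (a := t) ?_ ht
    linarith
  have hs : ∀ t : ℝ, 0 < t → t ≤ 1 →
      ‖p - q‖ ^ 2 ≤ inner ℝ (u - v) (p - q) + t * ‖p - q‖ ^ 2 := by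
    intro t ht ht1
    have h1 := key p q u hp hq hpm t ht ht1
    have h2 := key q p v hq hp hqm t ht ht1
    rw [← neg_sub p q, norm_neg, inner_neg_right] at h1
    have h3 : inner ℝ (p - u) (p - q) - inner ℝ (q - v) (p - q)
        = ‖p - q‖ ^ 2 - inner ℝ (u - v) (p - q) := by
      rw [← real_inner_self_eq_norm_sq, ← inner_sub_left, ← inner_sub_left]
      congr 1; abel
    have h4 : 0 ≤ (2 * c) * (inner ℝ (u - v) (p - q) + t * ‖p - q‖ ^ 2 - ‖p - q‖ ^ 2) := by
      nlinarith [congrArg (fun z => c * z) h3]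
    have := nonneg_of_mul_nonneg_right h4 (by positivity)
    linarith
  have hcs := real_inner_le_norm (u - v) (p - q)
  by_contra! hlt
  have hpos : 0 < ‖p - q‖ := (norm_nonneg _).trans_lt hlt
  have h := hs ((‖p - q‖ - ‖u - v‖) / (2 * ‖p - q‖))
    (div_pos (sub_pos.2 hlt) (by positivity))
    (by rw [div_le_one (by positivity)]; linarith [norm_nonneg (u - v)])
  have e : (‖p - q‖ - ‖u - v‖) / (2 * ‖p - q‖) * ‖p - q‖ ^ 2
    = (‖p - q‖ - ‖u - v‖) / 2 * ‖p - q‖ := by field_simp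
  rw [e] at h
  nlinarith [mul_pos (sub_pos.2 hlt) hpos]


/-- Running forward–backward splitting: tracking convergence under strong convexity. -/
theorem running_forward_backward_tracking
    {E : Type*} [NormedAddCommGroup E] [InnerProductSpace ℝ E] [CompleteSpace E]
    (M δ lam : ℝ) (hM : 0 < M) (hlam : lam ∈ Set.Ioo 0 (2 / M))
    (f : ℕ → E → ℝ) (f' : ℕ → E → E) (m Mk : ℕ → ℝ)
    (hm : ∀ k, 0 < m k) (hmMk : ∀ k, m k ≤ Mk k) (hMkM : ∀ k, Mk k ≤ M)
    (hsc : ∀ k, ConvexOn ℝ Set.univ (fun x => f k x - m k / 2 * ‖x‖ ^ 2))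
    (hgrad : ∀ k x, HasGradientAt (f k) (f' k x) x)
    (hlip : ∀ k x y, ‖f' k x - f' k y‖ ≤ Mk k * ‖x - y‖)
    (g : ℕ → E → ℝ) (hconvg : ∀ k, ConvexOn ℝ Set.univ (g k))
    (K : ℕ → Set E)
    (hK : ∀ k, (K k).Nonempty ∧ IsClosed (K k) ∧ Convex ℝ (K k))
    (xs : ℕ → E)
    (hfix : ∀ k, xs k ∈ K k ∧
      ∀ y ∈ K k, g k (xs k) + 1 / (2 * lam) * ‖xs k - (xs k - lam • f' k (xs k))‖ ^ 2
        ≤ g k y + 1 / (2 * lam) * ‖y - (xs k - lam • f' k (xs k))‖ ^ 2)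
    (hdrift : ∀ k, ‖xs (k + 1) - xs k‖ ≤ δ)
    (x : ℕ → E)
    (hx : ∀ k ≥ 1, x (k + 1) ∈ K k ∧
      ∀ y ∈ K k, g k (x (k + 1)) + 1 / (2 * lam) * ‖x (k + 1) - (x k - lam • f' k (x k))‖ ^ 2
        ≤ g k y + 1 / (2 * lam) * ‖y - (x k - lam • f' k (x k))‖ ^ 2)
    (L : ℕ → ℝ) (hL : ∀ k, L k = max |1 - lam * m k| |1 - lam * Mk k|)
    (Lbar : ℝ) (hLbar : Lbar ∈ Set.Ioo (0:ℝ) 1) (hLle : ∀ k, L k ≤ Lbar)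
    (k : ℕ) (hk : 1 ≤ k) :
    ‖x k - xs k‖ ≤ (∏ i ∈ Finset.Icc 1 (k - 1), L i) * ‖x 1 - xs 1‖
      + δ * (1 - Lbar ^ (k - 1)) / (1 - Lbar) := by
  have hlam0 : 0 < lam := hlam.1
  obtain ⟨hL0, hL1⟩ := hLbar
  have hδ : 0 ≤ δ := (norm_nonneg _).trans (hdrift 0)
  have hLnn : ∀ k, 0 ≤ L k := fun k => by
    rw [hL]; exact le_max_of_le_left (abs_nonneg _)
  have hstep : ∀ k ≥ 1, ‖x (k + 1) - xs (k + 1)‖ ≤ L k * ‖x k - xs k‖ + δ := by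
    intro k hk
    have h1 := fb_prox (g k) (hconvg k) (K k) (hK k).2.2 (1 / (2 * lam)) (by positivity)
      (x (k + 1)) (xs k) _ _ (hx k hk).1 (hfix k).1 (hx k hk).2 (hfix k).2
    have h2 := fb_forward (f k) (f' k) (m k) (Mk k) lam hlam0 (hmMk k) (hgrad k) (hsc k)
      (hlip k) (x k) (xs k)
    rw [← hL] at h2
    have h3 := norm_sub_le_norm_sub_add_norm_sub (x (k + 1)) (xs k) (xs (k + 1))
    rw [norm_sub_rev (xs k)] at h3
    linarith [hdrift k]
  have h1L : 0 < 1 - Lbar := sub_pos.2 hL1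
  induction k, hk using Nat.le_induction with
  | base => simp
  | succ k hk ih =>
    obtain ⟨n, rfl⟩ : ∃ n, k = n + 1 := ⟨k - 1, by omega⟩
    simp only [Nat.add_sub_cancel] at ih ⊢
    rw [Finset.prod_Icc_succ_top (by omega)]
    have hS : 0 ≤ δ * (1 - Lbar ^ n) / (1 - Lbar) :=
      div_nonneg (mul_nonneg hδ (sub_nonneg.2 (pow_le_one₀ hL0.le hL1.le))) h1L.le
    have h1 := hstep (n + 1) (by omega)
    have h2 := mul_le_mul_of_nonneg_left ih (hLnn (n + 1))
    have h3 := mul_le_mul_of_nonneg_right (hLle (n + 1)) hS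
    have e : δ * (1 - Lbar ^ (n + 1)) / (1 - Lbar)
        = Lbar * (δ * (1 - Lbar ^ n) / (1 - Lbar)) + δ := by
      field_simp; ring
    rw [e]
    linarith
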